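/- arXiv:1801.02968 — 2 statements merged into one kernel-verified Lean document; each statement's English description precedes it below -/
import Mathlib

section
/- Let s be a finite multiset of integers, each at least 3, with card s ≥ 3 and combinatorial curvature Φ(s) = 1 − (card s)/2 + Σ_{k ∈ s} 1/k ≥ 0. Then s contains at most one element (counted with multiplicity) that is ≥ 43. In particular, in a planar tessellation with nonnegative combinatorial curvature, no vertex is incident to two faces of degree at least 43. -/
/-- Combinatorial curvature of a vertex pattern `s` (multiset of face degrees). -/
def curvature (s : Multiset ℤ) : ℚ :=
  1 - (s.card : ℚ) / 2 + (s.map (fun k => (1 : ℚ) / (k : ℚ))).sum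

theorem curvature_eq (s : Multiset ℤ) :
    curvature s = 1 - (s.card : ℚ) / 2 + (s.map (fun k : ℤ => (1 : ℚ) / (k : ℚ))).sum := by
  simp [curvature]

/-- A sum of reciprocals of integers, each at least `m > 0`, is at most the number of terms
divided by `m`. -/
theorem Multiset.sum_map_one_div_le_card_div (s : Multiset ℤ) {m : ℤ} (hm : 0 < m)
    (h : ∀ k ∈ s, m ≤ k) :
    (s.map (fun k : ℤ => (1 : ℚ) / (k : ℚ))).sum ≤ (s.card : ℚ) / m := by
  have hsum := Multiset.sum_le_card_nsmul (s.map (fun k : ℤ => (1 : ℚ) / (k : ℚ)))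
    (1 / (m : ℚ)) (by
      intro x hx
      obtain ⟨k, hk, rfl⟩ := Multiset.mem_map.1 hx
      exact one_div_le_one_div_of_le (by exact_mod_cast hm) (by exact_mod_cast h k hk))
  rwa [Multiset.card_map, nsmul_eq_mul, mul_one_div] at hsum

theorem at_most_one_large_face (s : Multiset ℤ)
    (h3 : ∀ k ∈ s, (3 : ℤ) ≤ k) (hcard : 3 ≤ Multiset.card s)
    (hΦ : 0 ≤ curvature s) :
    Multiset.card (s.filter (fun k => 43 ≤ k)) ≤ 1 := by
  by_contra! hlarge
  have hsplit := Multiset.filter_add_not (fun k : ℤ => 43 ≤ k) s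
  have hF := (s.filter (fun k => 43 ≤ k)).sum_map_one_div_le_card_div (m := 43) (by norm_num)
    fun k hk => (Multiset.mem_filter.1 hk).2
  have hR := (s.filter (fun k => ¬ 43 ≤ k)).sum_map_one_div_le_card_div (m := 3) (by norm_num)
    fun k hk => h3 k (Multiset.mem_filter.1 hk).1
  rw [curvature_eq, ← hsplit, Multiset.map_add, Multiset.sum_add, Multiset.card_add] at hΦ
  rw [← hsplit, Multiset.card_add] at hcard
  have hcard' : (3 : ℚ) ≤ ((s.filter (fun k => 43 ≤ k)).card : ℚ) +
      ((s.filter (fun k => ¬ 43 ≤ k)).card : ℚ) := by exact_mod_cast hcard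
  have hlarge' : (2 : ℚ) ≤ ((s.filter (fun k => 43 ≤ k)).card : ℚ) := by exact_mod_cast hlarge
  push_cast at hΦ hF hR
  linarith
end

section
/- Let s be a finite multiset of integers, each at least 3, with card s ≥ 3 and combinatorial curvature Φ(s) = 1 − (card s)/2 + Σ_{k ∈ s} 1/k ≥ 0. If s contains both the element 4 and the element 5, then s is one of the following: {4,5,l} for some integer 3 ≤ l ≤ 20 (this includes {3,4,5} and {4,4,5}), or {3,3,4,5}, or {3,4,4,5}. -/
theorem curvature_cons (a : ℤ) (s : Multiset ℤ) :
    curvature (a ::ₘ s) = curvature s + (1 / (a : ℚ) - 1 / 2) := by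
  simp only [curvature, Multiset.bind_def, Multiset.pure_def, Multiset.bind_singleton,
    Multiset.card_cons, Multiset.map_cons, Multiset.sum_cons]
  push_cast
  ring

theorem curvature_zero : curvature 0 = 1 := by
  simp [curvature]

theorem one_div_intCast_le {m k : ℤ} (hm : 0 < m) (hk : m ≤ k) : 1 / (k : ℚ) ≤ 1 / (m : ℚ) :=
  one_div_le_one_div_of_le (by exact_mod_cast hm) (by exact_mod_cast hk)

theorem curvature_le_of_forall_three_le (s : Multiset ℤ) (h : ∀ k ∈ s, (3 : ℤ) ≤ k) :
    curvature s ≤ 1 - (Multiset.card s : ℚ) / 6 := by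
  induction s using Multiset.induction_on with
  | empty => simp [curvature]
  | cons a s ih =>
    have hs := ih fun k hk => h k (Multiset.mem_cons_of_mem hk)
    have ha := one_div_intCast_le three_pos (h a (Multiset.mem_cons_self a s))
    rw [curvature_cons, Multiset.card_cons]
    push_cast at ha ⊢
    linarith

theorem patterns_with_four_and_five (s : Multiset ℤ)
    (h3 : ∀ k ∈ s, (3 : ℤ) ≤ k) (hcard : 3 ≤ Multiset.card s)
    (hΦ : 0 ≤ curvature s) (h4mem : (4 : ℤ) ∈ s) (h5mem : (5 : ℤ) ∈ s) :
    (∃ l : ℤ, 3 ≤ l ∧ l ≤ 20 ∧ s = {4, 5, l}) ∨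
      s = {3, 3, 4, 5} ∨ s = {3, 4, 4, 5} := by
  obtain ⟨u, rfl⟩ := Multiset.exists_cons_of_mem h4mem
  obtain ⟨t, rfl⟩ := Multiset.exists_cons_of_mem
    ((Multiset.mem_cons.mp h5mem).resolve_left (by norm_num))
  have ht : ∀ k ∈ t, (3 : ℤ) ≤ k := fun k hk => h3 k (by simp [hk])
  have hle := curvature_le_of_forall_three_le t ht
  simp only [curvature_cons] at hΦ
  push_cast at hΦ
  simp only [Multiset.card_cons] at hcard
  have hlt : Multiset.card t < 3 := by
    have : (Multiset.card t : ℚ) < 3 := by linarith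
    exact_mod_cast this
  obtain h1 | h2 : Multiset.card t = 1 ∨ Multiset.card t = 2 := by omega
  · obtain ⟨l, rfl⟩ := Multiset.card_eq_one.mp h1
    refine Or.inl ⟨l, ht l (by simp), ?_, rfl⟩
    by_contra! hl
    have := one_div_intCast_le (m := 21) (by norm_num) hl
    rw [← Multiset.cons_zero, curvature_cons, curvature_zero] at hΦ
    push_cast at this
    linarith
  · obtain ⟨a, b, rfl⟩ := Multiset.card_eq_two.mp h2
    wlog hab : a ≤ b generalizing a b
    · rw [Multiset.pair_comm a b] at *
      exact this b a h3 h4mem h5mem ht hle hΦ hcard hlt h2 (le_of_not_ge hab)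
    have ha := ht a (by simp)
    rw [Multiset.insert_eq_cons, ← Multiset.cons_zero b, curvature_cons, curvature_cons,
      curvature_zero] at hΦ
    have ha3 : a = 3 := by
      by_contra hne
      have h4a := one_div_intCast_le (m := 4) (k := a) (by norm_num) (by omega)
      have h4b := one_div_intCast_le (m := 4) (k := b) (by norm_num) (by omega)
      push_cast at h4a h4b
      linarith
    subst ha3
    have hb4 : b ≤ 4 := by
      by_contra! hb
      have h5b := one_div_intCast_le (m := 5) (by norm_num) hb
      push_cast at h5b hΦ
      linarith
    obtain rfl | rfl : b = 3 ∨ b = 4 := by omega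
    · exact Or.inr (Or.inl (by decide))
    · exact Or.inr (Or.inr (by decide))
end
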